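/- Let d, h, m be positive integers. If the triple (d+1, h, m+1) is admissible, then the triple (d, h, m) is admissible. (Proof idea: embed ℝ^d in ℝ^{d+1} as the hyperplane with last coordinate zero, thicken the m given masses by ε > 0 in the last coordinate direction, add as an (m+1)-st mass a ball of radius 1/2 centered at (0,…,0,1), equipartition these m+1 masses by h hyperplanes — which must all pass through the center of the ball and hence intersect ℝ^d in hyperplanes of ℝ^d — and conclude by a limit argument as ε → 0.) -/

import Mathlib

open MeasureTheory

/-- A *mass* in `ℝ^d`: a finite Borel measure for which every affine hyperplane
(zero set of an affine functional with nonzero linear part) is a null set. -/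
def IsMass (d : ℕ) (μ : Measure (Fin d → ℝ)) : Prop :=
  IsFiniteMeasure μ ∧
    ∀ f : (Fin d → ℝ) →ᵃ[ℝ] ℝ, f.linear ≠ 0 → μ {x | f x = 0} = 0

/-- The `h` hyperplanes determined by the nonzero affine functionals `f i`
cut the mass `μ` into `2^h` equal pieces: every orthant given by a sign
vector `ε ∈ {−1,+1}^h` (encoded by `Bool`) has measure `μ(ℝ^d)/2^h`. -/
def Cuts (d h : ℕ) (f : Fin h → ((Fin d → ℝ) →ᵃ[ℝ] ℝ))
    (μ : Measure (Fin d → ℝ)) : Prop :=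
  ∀ ε : Fin h → Bool,
    μ {x | ∀ i, 0 ≤ (if ε i then f i x else -(f i x))} = μ Set.univ / 2 ^ h

/-- `(d, h, m)` is admissible: any `m` masses in `ℝ^d` can be simultaneously cut
into `2^h` equal pieces by `h` affine hyperplanes. -/
def Admissible (d h m : ℕ) : Prop :=
  ∀ μ : Fin m → Measure (Fin d → ℝ), (∀ j, IsMass d (μ j)) →
    ∃ f : Fin h → ((Fin d → ℝ) →ᵃ[ℝ] ℝ),
      (∀ i, (f i).linear ≠ 0) ∧ ∀ j, Cuts d h f (μ j)

/-- `Δ(h, m)`: the smallest positive dimension `d` such that `(d, h, m)` is admissible. -/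
noncomputable def Delta (h m : ℕ) : ℕ := sInf {d | 0 < d ∧ Admissible d h m}

/-- The affine embedding `x ↦ (s, s • x)` of `ℝ^d` as the slice at height `s` of the cone over
`ℝ^d` with apex at the origin of `ℝ^(d+1)`. -/
def coneSlice (d : ℕ) (s : ℝ) : (Fin d → ℝ) →ᵃ[ℝ] (Fin (d + 1) → ℝ) where
  toFun x := Fin.cons s (s • x)
  linear :=
    { toFun := fun x => Fin.cons 0 (s • x)
      map_add' := fun x y => by ext i; refine Fin.cases ?_ (fun i => ?_) i <;> simp
      map_smul' := fun c x => by
        ext i; refine Fin.cases ?_ (fun i => ?_) i <;> simp [mul_left_comm] }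
  map_vadd' x v := by ext i; refine Fin.cases ?_ (fun i => ?_) i <;> simp

theorem coneSlice_apply (d : ℕ) (s : ℝ) (x : Fin d → ℝ) :
    coneSlice d s x = Fin.cons s (s • x) := rfl

theorem coneSlice_eq_smul (d : ℕ) (s : ℝ) (x : Fin d → ℝ) :
    coneSlice d s x = s • coneSlice d 1 x := by
  ext i
  refine Fin.cases ?_ (fun i => ?_) i <;> simp [coneSlice_apply]

theorem coneSlice_linear_eq_smul (d : ℕ) (s : ℝ) :
    (coneSlice d s).linear = s • (coneSlice d 1).linear := by
  ext1 x
  ext i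
  refine Fin.cases ?_ (fun i => ?_) i <;> simp [coneSlice]

theorem measurable_coneSlice (d : ℕ) :
    Measurable fun p : ℝ × (Fin d → ℝ) => coneSlice d p.1 p.2 := by
  refine measurable_pi_lambda _ fun i => ?_
  refine Fin.cases ?_ (fun i => ?_) i
  · simpa [coneSlice_apply] using measurable_fst
  · simp only [coneSlice_apply, Fin.cons_succ, Pi.smul_apply, smul_eq_mul]
    fun_prop

/-- The measure on `ℝ^(d+1)` obtained by spreading `μ` uniformly over the slices of the cone over
`ℝ^d` at heights between `1` and `2`. -/
noncomputable def coneMeasure {d : ℕ} (μ : Measure (Fin d → ℝ)) : Measure (Fin (d + 1) → ℝ) :=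
  ((volume.restrict (Set.Icc (1 : ℝ) 2)).prod μ).map fun p => coneSlice d p.1 p.2

theorem coneMeasure_apply {d : ℕ} (μ : Measure (Fin d → ℝ)) [IsFiniteMeasure μ]
    {t : Set (Fin (d + 1) → ℝ)} (ht : MeasurableSet t) :
    coneMeasure μ t = ∫⁻ s in Set.Icc (1 : ℝ) 2, μ (coneSlice d s ⁻¹' t) := by
  rw [coneMeasure, Measure.map_apply (measurable_coneSlice d) ht,
    Measure.prod_apply (measurable_coneSlice d ht)]
  rfl

/-- A measurable set all of whose slices look the same has the same measure as its slices. -/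
theorem coneMeasure_apply_of_forall_preimage_eq {d : ℕ} (μ : Measure (Fin d → ℝ))
    [IsFiniteMeasure μ] {t : Set (Fin (d + 1) → ℝ)} (ht : MeasurableSet t) {u : Set (Fin d → ℝ)}
    (h : ∀ s : ℝ, 0 < s → coneSlice d s ⁻¹' t = u) : coneMeasure μ t = μ u := by
  rw [coneMeasure_apply μ ht, setLIntegral_congr_fun (g := fun _ => μ u) measurableSet_Icc
    fun s hs => by simp only [h s (one_pos.trans_le hs.1)]]
  norm_num

theorem coneMeasure_univ {d : ℕ} (μ : Measure (Fin d → ℝ)) [IsFiniteMeasure μ] :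
    coneMeasure μ Set.univ = μ Set.univ :=
  coneMeasure_apply_of_forall_preimage_eq μ .univ fun _ _ => Set.preimage_univ

/-- A linear functional on `ℝ^(d+1)` vanishing on the slice `x₀ = 1` of the cone vanishes. -/
theorem linear_eq_zero_of_comp_coneSlice {d : ℕ} {l : (Fin (d + 1) → ℝ) →ₗ[ℝ] ℝ}
    (h₁ : l ∘ₗ (coneSlice d 1).linear = 0)
    (h₀ : l (coneSlice d 1 0) = 0) : l = 0 := by
  refine LinearMap.ext fun y => ?_
  have hy : y = (coneSlice d 1).linear (Fin.tail y) + y 0 • coneSlice d 1 0 := by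
    ext i
    refine Fin.cases ?_ (fun i => ?_) i <;> simp [coneSlice, Fin.tail]
  have h₂ : l ((coneSlice d 1).linear (Fin.tail y)) = 0 := LinearMap.congr_fun h₁ _
  rw [hy, map_add, map_smul, h₀, h₂]
  simp

theorem measurable_affine {d : ℕ} (f : (Fin d → ℝ) →ᵃ[ℝ] ℝ) : Measurable f :=
  f.continuous_of_finiteDimensional.measurable

theorem affine_apply_smul {d : ℕ} (f : (Fin d → ℝ) →ᵃ[ℝ] ℝ) (s : ℝ) (y : Fin d → ℝ) :
    f (s • y) = s * f.linear y + f 0 := by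
  rw [f.decomp]
  simp

theorem IsMass.coneMeasure {d : ℕ} {μ : Measure (Fin d → ℝ)} (hμ : IsMass d μ) :
    IsMass (d + 1) (coneMeasure μ) := by
  have := hμ.1
  refine ⟨⟨by rw [coneMeasure_univ]; exact measure_lt_top _ _⟩, fun f hf => ?_⟩
  change _root_.coneMeasure μ (f ⁻¹' {0}) = 0
  rw [coneMeasure_apply μ (measurable_affine f (measurableSet_singleton 0)),
    ← lintegral_zero (μ := volume.restrict (Set.Icc (1 : ℝ) 2))]
  refine lintegral_congr_ae ?_
  by_cases hg : f.linear ∘ₗ (coneSlice d 1).linear = 0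
  · have hc : f.linear (coneSlice d 1 0) ≠ 0 := fun h =>
      hf (linear_eq_zero_of_comp_coneSlice hg h)
    filter_upwards [Measure.ae_ne (volume.restrict (Set.Icc (1 : ℝ) 2))
      (-f 0 / f.linear (coneSlice d 1 0))] with s hs
    convert measure_empty (μ := μ)
    refine Set.eq_empty_of_forall_notMem fun x hx => hs ?_
    have hx' : f (coneSlice d s x) = 0 := hx
    have h₁ : f.linear (coneSlice d 1 x) = f.linear (coneSlice d 1 0) := by
      rw [(coneSlice d 1).decomp]
      have h₂ : f.linear ((coneSlice d 1).linear x) = 0 := LinearMap.congr_fun hg x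
      simp [h₂]
    rw [coneSlice_eq_smul, affine_apply_smul, h₁] at hx'
    rw [eq_div_iff hc]
    linarith
  · filter_upwards [ae_restrict_mem measurableSet_Icc] with s hs
    refine hμ.2 (f.comp (coneSlice d s)) ?_
    have hs₀ : s ≠ 0 := (one_pos.trans_le hs.1).ne'
    rw [AffineMap.comp_linear, coneSlice_linear_eq_smul, LinearMap.comp_smul]
    exact smul_ne_zero hs₀ hg

theorem measurableSet_orthant {d h : ℕ} (f : Fin h → ((Fin d → ℝ) →ᵃ[ℝ] ℝ)) (ε : Fin h → Bool) :
    MeasurableSet {x | ∀ i, 0 ≤ (if ε i then f i x else -(f i x))} := by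
  rw [Set.ofPred_forall]
  refine .iInter fun i => ?_
  split_ifs
  · exact measurableSet_le measurable_const (measurable_affine (f i))
  · exact measurableSet_le measurable_const (measurable_affine (f i)).neg

/-- Hyperplanes through the apex that cut the cone over `μ` also cut `μ`. -/
theorem Cuts.comp_coneSlice {d h : ℕ} {μ : Measure (Fin d → ℝ)} [IsFiniteMeasure μ]
    {f : Fin h → ((Fin (d + 1) → ℝ) →ᵃ[ℝ] ℝ)} (hf : Cuts (d + 1) h f (coneMeasure μ))
    (h₀ : ∀ i, f i 0 = 0) : Cuts d h (fun i => (f i).comp (coneSlice d 1)) μ := by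
  intro ε
  rw [← coneMeasure_univ μ, ← hf ε]
  refine (coneMeasure_apply_of_forall_preimage_eq μ (measurableSet_orthant f ε) fun s hs => ?_).symm
  ext x
  refine forall_congr' fun i => ?_
  have h₁ : f i (coneSlice d s x) = s * f i (coneSlice d 1 x) := by
    have := affine_apply_smul (f i) 1 (coneSlice d 1 x)
    rw [one_smul, one_mul] at this
    rw [coneSlice_eq_smul, affine_apply_smul, this, h₀, add_zero, add_zero]
  split_ifs
  · simp [h₁, hs]
  · simp only [h₁, AffineMap.comp_apply, ← mul_neg, mul_nonneg_iff_of_pos_left hs]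

/-- Each of the hyperplanes cutting `μ` leaves at most half of `μ` on each side. -/
theorem Cuts.two_mul_measure_le {d h : ℕ} {μ : Measure (Fin d → ℝ)}
    {f : Fin h → ((Fin d → ℝ) →ᵃ[ℝ] ℝ)} (hf : Cuts d h f μ) (i : Fin h) (b : Bool) :
    2 * μ {x | 0 ≤ (if b then f i x else -(f i x))} ≤ μ Set.univ := by
  obtain _ | n := h
  · exact i.elim0
  have hsub : {x | 0 ≤ (if b then f i x else -(f i x))} ⊆
      ⋃ ε : Fin n → Bool, {x | ∀ k, 0 ≤
        (if (i.insertNth b ε : Fin (n + 1) → Bool) k then f k x else -(f k x))} := by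
    intro x hx
    refine Set.mem_iUnion.2 ⟨fun k => decide (0 ≤ f (i.succAbove k) x), fun k => ?_⟩
    refine Fin.succAboveCases i ?_ (fun k => ?_) k
    · simpa using hx
    · rw [Fin.insertNth_apply_succAbove]
      by_cases h : 0 ≤ f (i.succAbove k) x
      · simp [h]
      · simpa [h] using (not_le.1 h).le
  calc 2 * μ {x | 0 ≤ (if b then f i x else -(f i x))}
      ≤ 2 * ∑ ε : Fin n → Bool, μ {x | ∀ k, 0 ≤
        (if (i.insertNth b ε : Fin (n + 1) → Bool) k then f k x else -(f k x))} := by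
        gcongr
        exact (measure_mono hsub).trans (measure_iUnion_fintype_le _ _)
    _ = 2 ^ (n + 1) * (μ Set.univ / 2 ^ (n + 1)) := by
        simp only [hf _, Finset.sum_const, Finset.card_univ, Fintype.card_fun, Fintype.card_bool,
          Fintype.card_fin, nsmul_eq_mul, Nat.cast_pow, Nat.cast_ofNat]
        rw [← mul_assoc, pow_succ']
    _ = μ Set.univ := ENNReal.mul_div_cancel (by simp) (by simp)

theorem isMass_volume_restrict_ball (d : ℕ) :
    IsMass d (volume.restrict (Metric.ball (0 : Fin d → ℝ) 1)) := by
  refine ⟨⟨by simp⟩, fun f hf => ?_⟩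
  refine nonpos_iff_eq_zero.1 ((Measure.restrict_apply_le _ _).trans_eq ?_)
  obtain ⟨v, hv⟩ : ∃ v, f.linear v ≠ 0 := by
    by_contra! h
    exact hf (LinearMap.ext h)
  let S : AffineSubspace ℝ (Fin d → ℝ) := (AffineSubspace.mk' (0 : ℝ) ⊥).comap f
  have hS : (S : Set (Fin d → ℝ)) = {x | f x = 0} := by
    ext x
    simp [S, AffineSubspace.mem_mk']
  rw [← hS]
  refine Measure.addHaar_affineSubspace _ S fun htop => ?_
  have hall : ∀ x, f x = 0 := fun x => by
    have : x ∈ (S : Set (Fin d → ℝ)) := by rw [htop]; trivial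
    rwa [hS] at this
  apply hv
  have := f.map_vadd 0 v
  simpa [hall] using this.symm

/-- A half-space containing at most half of a ball around the origin does not contain the origin in
its interior. -/
theorem apply_zero_nonpos_of_two_mul_measure_le {d : ℕ} (f : (Fin d → ℝ) →ᵃ[ℝ] ℝ)
    (hf : 2 * volume.restrict (Metric.ball (0 : Fin d → ℝ) 1) {x | 0 ≤ f x} ≤
      volume.restrict (Metric.ball (0 : Fin d → ℝ) 1) Set.univ) : f 0 ≤ 0 := by
  by_contra! h₀
  set B := Metric.ball (0 : Fin d → ℝ) 1 with hB
  set ν := (volume : Measure (Fin d → ℝ)).restrict B with hν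
  have hfin : ∀ t, ν t ≠ ⊤ :=
    have := (isMass_volume_restrict_ball d).1
    fun t => measure_ne_top ν t
  have hcont : Continuous f := f.continuous_of_finiteDimensional
  have hneg : ∀ x, f (-x) = 2 * f 0 - f x := fun x => by
    have h₁ := affine_apply_smul f (-1) x
    have h₂ := affine_apply_smul f 1 x
    rw [neg_one_smul] at h₁
    rw [one_smul] at h₂
    linarith
  have hfm := measurable_affine f
  have hsymm : ν {x | f x ≤ 0} = ν {x | 2 * f 0 ≤ f x} := by
    rw [hν, Measure.restrict_apply (measurableSet_le hfm measurable_const),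
      Measure.restrict_apply (measurableSet_le measurable_const hfm), ← Measure.measure_neg]
    congr 1
    ext x
    simp [hneg, hB]
  have hpos : 0 < ν {x | 0 ≤ f x ∧ f x < 2 * f 0} := by
    have hU : IsOpen ({x | 0 < f x ∧ f x < 2 * f 0} ∩ B) :=
      ((isOpen_lt continuous_const hcont).inter (isOpen_lt hcont continuous_const)).inter
        Metric.isOpen_ball
    refine (hU.measure_pos volume ⟨0, ⟨h₀, by linarith⟩, by simp [hB]⟩).trans_le ?_
    refine (Measure.le_restrict_apply _ _).trans (measure_mono fun x hx => ⟨hx.1.le, hx.2⟩)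
  have hsplit : ν {x | 0 ≤ f x} =
      ν {x | 0 ≤ f x ∧ f x < 2 * f 0} + ν {x | 2 * f 0 ≤ f x} := by
    rw [← measure_union _ (measurableSet_le measurable_const hfm)]
    · congr 1
      ext x
      simp only [Set.mem_ofPred_eq, Set.mem_union]
      grind
    · exact Set.disjoint_left.2 fun x hx hx' => hx.2.not_ge hx'
  have huniv : ν Set.univ ≤ ν {x | f x ≤ 0} + ν {x | 0 ≤ f x} :=
    (measure_mono fun x _ => le_total (f x) 0).trans (measure_union_le _ _)
  have hlt : ν {x | f x ≤ 0} < ν {x | 0 ≤ f x} := by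
    rw [hsymm, hsplit, add_comm]
    exact ENNReal.lt_add_right (hfin _) hpos.ne'
  refine (hf.trans huniv).not_gt ?_
  rw [two_mul]
  exact ENNReal.add_lt_add_right (hfin _) hlt

/-- Hyperplanes cutting a ball into equal pieces pass through its center. -/
theorem Cuts.apply_zero_eq_zero {d h : ℕ} {f : Fin h → ((Fin d → ℝ) →ᵃ[ℝ] ℝ)}
    (hf : Cuts d h f (volume.restrict (Metric.ball 0 1))) (i : Fin h) : f i 0 = 0 := by
  refine le_antisymm (apply_zero_nonpos_of_two_mul_measure_le (f i) ?_)
    (neg_nonpos.1 (apply_zero_nonpos_of_two_mul_measure_le (-f i) ?_))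
  · simpa using hf.two_mul_measure_le i true
  · simpa using hf.two_mul_measure_le i false

/-- A nonzero constant functional can only take part in cutting the zero measure. -/
theorem Cuts.eq_zero_of_linear_eq_zero {d h : ℕ} {μ : Measure (Fin d → ℝ)}
    {f : Fin h → ((Fin d → ℝ) →ᵃ[ℝ] ℝ)} (hf : Cuts d h f μ) {i : Fin h}
    (hi : (f i).linear = 0) (h₀ : f i 0 ≠ 0) : μ = 0 := by
  have hconst : ∀ x, f i x = f i 0 := fun x => by rw [(f i).decomp]; simp [hi]
  have hempty : {x | ∀ k, 0 ≤ (if decide (f i 0 < 0) then f k x else -(f k x))} = ∅ := by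
    refine Set.eq_empty_of_forall_notMem fun x hx => ?_
    have := hx i
    rw [hconst] at this
    grind
  have := hf fun _ => decide (f i 0 < 0)
  rw [hempty, measure_empty] at this
  rw [← Measure.measure_univ_eq_zero]
  simpa [ENNReal.div_eq_zero_iff] using this.symm

/-- if `(d+1, h, m+1)` is admissible then so is `(d, h, m)`. -/
theorem admissible_of_admissible_succ_succ (d h m : ℕ) (hd : 0 < d) (hh : 0 < h)
    (hm : 0 < m) (H : Admissible (d + 1) h (m + 1)) : Admissible d h m := by
  intro μ hμ
  have := fun j => (hμ j).1
  by_cases hzero : ∀ j, μ j = 0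
  · refine ⟨fun _ => (LinearMap.proj (⟨0, hd⟩ : Fin d)).toAffineMap, fun _ h₀ => ?_, fun j ε => ?_⟩
    · simpa using LinearMap.congr_fun h₀ 1
    · simp [hzero j]
  obtain ⟨j, hj⟩ := not_forall.1 hzero
  obtain ⟨f, hf, hcut⟩ := H
    (Fin.cons (volume.restrict (Metric.ball 0 1)) fun j => coneMeasure (μ j))
    (Fin.cases (isMass_volume_restrict_ball _) fun j => (hμ j).coneMeasure)
  have h₀ : ∀ i, f i 0 = 0 := (hcut 0).apply_zero_eq_zero
  have hcut' : ∀ j, Cuts d h (fun i => (f i).comp (coneSlice d 1)) (μ j) := fun j =>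
    (hcut j.succ).comp_coneSlice h₀
  refine ⟨_, fun i hi => hj ((hcut' j).eq_zero_of_linear_eq_zero hi fun hc => hf i ?_), hcut'⟩
  refine linear_eq_zero_of_comp_coneSlice hi ?_
  have h₁ := affine_apply_smul (f i) 1 (coneSlice d 1 0)
  rw [one_smul, one_mul, h₀, add_zero] at h₁
  exact h₁.symm.trans hc
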